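/- Let Ω ⊂ ℝ^N be a bounded C² domain and u its torsion function (Δu = N in Ω, u = 0 on ∂Ω). Then max over the closure of Ω of (-u) is at most (1/2)(|Ω|/|B₁|)^{2/N}, where |B₁| is the volume of the unit ball. -/

import Mathlib

open MeasureTheory Metric

/-- The Laplacian `Δu` at `x`, as the sum of pure second derivatives. -/
noncomputable def lap {N : ℕ} (u : EuclideanSpace ℝ (Fin N) → ℝ)
    (x : EuclideanSpace ℝ (Fin N)) : ℝ :=
  ∑ i, iteratedFDeriv ℝ 2 u x ![EuclideanSpace.single i 1, EuclideanSpace.single i 1]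

/-- The squared Frobenius norm `|D²u|²` of the Hessian of `u` at `x`. -/
noncomputable def hessNormSq {N : ℕ} (u : EuclideanSpace ℝ (Fin N) → ℝ)
    (x : EuclideanSpace ℝ (Fin N)) : ℝ :=
  ∑ i, ∑ j, (iteratedFDeriv ℝ 2 u x ![EuclideanSpace.single i 1, EuclideanSpace.single j 1])^2

/-- Mean curvature of a hypersurface at `x`, computed from an outward unit normal field `ν`
as `(1/(N-1)) · div ν`. -/
noncomputable def meanCurv {N : ℕ} (ν : EuclideanSpace ℝ (Fin N) → EuclideanSpace ℝ (Fin N))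
    (x : EuclideanSpace ℝ (Fin N)) : ℝ :=
  (((N : ℝ) - 1)⁻¹) *
    ∑ i, @inner ℝ _ _ (fderiv ℝ ν x (EuclideanSpace.single i 1)) (EuclideanSpace.single i 1)

section

open scoped ENNReal Pointwise

/-- The one-dimensional Brunn-Minkowski inequality for compact sets. -/
lemma volume_add_volume_le_volume_add {K L : Set ℝ} (hK : IsCompact K) (hL : IsCompact L)
    (hK0 : K.Nonempty) (hL0 : L.Nonempty) :
    volume K + volume L ≤ volume (K + L) := by
  have hsub : (fun x => sInf L + x) '' K ∪ (fun x => sSup K + x) '' L ⊆ K + L := by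
    rintro _ (⟨x, hx, rfl⟩ | ⟨x, hx, rfl⟩)
    · exact ⟨x, hx, sInf L, hL.sInf_mem hL0, add_comm _ _⟩
    · exact ⟨sSup K, hK.sSup_mem hK0, x, hx, rfl⟩
  have hinter : (fun x => sInf L + x) '' K ∩ (fun x => sSup K + x) '' L ⊆ {sInf L + sSup K} := by
    rintro _ ⟨⟨x, hx, rfl⟩, y, hy, hxy⟩
    have hxK := le_csSup hK.bddAbove hx
    have hyL := csInf_le hL.bddBelow hy
    simp only [Set.mem_singleton_iff] at hxy ⊢
    linarith
  have hnull : volume ((fun x => sInf L + x) '' K ∩ (fun x => sSup K + x) '' L) = 0 :=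
    measure_mono_null hinter (measure_singleton _)
  have hmeas : MeasurableSet ((fun x => sSup K + x) '' L) :=
    (hL.image (by fun_prop)).measurableSet
  have hunion := measure_union_add_inter (μ := volume) ((fun x => sInf L + x) '' K) hmeas
  rw [hnull, add_zero] at hunion
  simp only [Set.image_add_left, measure_preimage_add] at hunion hsub
  exact hunion ▸ measure_mono hsub

/-- The one-dimensional Brunn-Minkowski inequality for convex combinations of measurable sets. -/
lemma mul_volume_add_mul_volume_le {A B C : Set ℝ} {l : ℝ} (hl0 : 0 < l) (hl1 : l < 1)
    (hA : MeasurableSet A) (hB : MeasurableSet B) (hA0 : A.Nonempty) (hB0 : B.Nonempty)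
    (hC : ∀ a ∈ A, ∀ b ∈ B, l * a + (1 - l) * b ∈ C) :
    ENNReal.ofReal l * volume A + ENNReal.ofReal (1 - l) * volume B ≤ volume C := by
  obtain ⟨a, ha⟩ := hA0
  obtain ⟨b, hb⟩ := hB0
  rw [hA.measure_eq_iSup_isCompact, hB.measure_eq_iSup_isCompact]
  simp only [iSup_and', ENNReal.mul_iSup]
  refine ENNReal.biSup_add_biSup_le' ⟨∅, Set.empty_subset _, isCompact_empty⟩
    ⟨∅, Set.empty_subset _, isCompact_empty⟩ fun K ⟨hKA, hK⟩ L ⟨hLB, hL⟩ => ?_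
  have key := volume_add_volume_le_volume_add (K := l • (insert a K)) (L := (1 - l) • (insert b L))
    ((hK.insert a).smul l) ((hL.insert b).smul (1 - l))
    ((Set.insert_nonempty _ _).smul_set) ((Set.insert_nonempty _ _).smul_set)
  rw [Measure.addHaar_smul, Measure.addHaar_smul] at key
  simp only [Module.finrank_self, pow_one, abs_of_pos hl0, abs_of_pos (sub_pos.2 hl1)] at key
  calc _ ≤ ENNReal.ofReal l * volume (insert a K) +
        ENNReal.ofReal (1 - l) * volume (insert b L) := by
        gcongr <;> exact Set.subset_insert _ _
    _ ≤ _ := key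
    _ ≤ _ := by
        apply measure_mono
        rintro _ ⟨_, ⟨x, hx, rfl⟩, _, ⟨y, hy, rfl⟩, rfl⟩
        exact hC x (Set.insert_subset ha hKA hx) y (Set.insert_subset hb hLB hy)

lemma ennreal_geom_mean_le_arith_mean {l : ℝ} (hl0 : 0 < l) (hl1 : l < 1) (x y : ℝ≥0∞) :
    x ^ l * y ^ (1 - l) ≤ ENNReal.ofReal l * x + ENNReal.ofReal (1 - l) * y := by
  have hl1' : 0 < 1 - l := sub_pos.2 hl1
  by_cases hx : x = ⊤
  · simp [hx, ENNReal.mul_top, hl0]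
  by_cases hy : y = ⊤
  · simp [hy, ENNReal.mul_top, hl1]
  lift x to NNReal using hx
  lift y to NNReal using hy
  have := NNReal.geom_mean_le_arith_mean2_weighted l.toNNReal (1 - l).toNNReal x y
    (by rw [← Real.toNNReal_add hl0.le hl1'.le]; simp)
  rw [Real.coe_toNNReal _ hl0.le, Real.coe_toNNReal _ hl1'.le] at this
  rw [← ENNReal.coe_rpow_of_nonneg _ hl0.le, ← ENNReal.coe_rpow_of_nonneg _ hl1'.le]
  simp only [ENNReal.ofReal]
  exact_mod_cast this

/-- The one-dimensional Prékopa-Leindler inequality for functions with supremum `1`. -/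
lemma prekopa_leindler_of_sup_eq_one {f g h : ℝ → ℝ} {l : ℝ} (hl0 : 0 < l) (hl1 : l < 1)
    (hf : Measurable f) (hg : Measurable g) (hh : Measurable h)
    (hf0 : ∀ x, 0 ≤ f x) (hg0 : ∀ x, 0 ≤ g x) (hh0 : ∀ x, 0 ≤ h x)
    (hf1 : ∀ x, f x ≤ 1) (hg1 : ∀ x, g x ≤ 1)
    (hf2 : ∀ t < 1, ∃ x, t < f x) (hg2 : ∀ t < 1, ∃ x, t < g x)
    (H : ∀ x y, f x ^ l * g y ^ (1 - l) ≤ h (l * x + (1 - l) * y)) :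
    ENNReal.ofReal l * (∫⁻ x, ENNReal.ofReal (f x)) + ENNReal.ofReal (1 - l) *
      ∫⁻ x, ENNReal.ofReal (g x) ≤ ∫⁻ x, ENNReal.ofReal (h x) := by
  have hl1' : 0 < 1 - l := sub_pos.2 hl1
  rw [lintegral_eq_lintegral_meas_lt _ (.of_forall hf0) hf.aemeasurable,
    lintegral_eq_lintegral_meas_lt _ (.of_forall hg0) hg.aemeasurable,
    lintegral_eq_lintegral_meas_lt _ (.of_forall hh0) hh.aemeasurable]
  have hmeas : ∀ k : ℝ → ℝ, Measurable fun t : ℝ => volume {a | t < k a} := fun k =>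
    Antitone.measurable fun s t hst => measure_mono fun a ha => lt_of_le_of_lt hst ha
  rw [← lintegral_const_mul _ (hmeas f), ← lintegral_const_mul _ (hmeas g),
    ← lintegral_add_left ((hmeas f).const_mul _)]
  refine setLIntegral_mono (hmeas h) fun t (ht : 0 < t) => ?_
  rcases lt_or_ge t 1 with ht1 | ht1
  · refine mul_volume_add_mul_volume_le hl0 hl1 (hf measurableSet_Ioi) (hg measurableSet_Ioi)
      (hf2 t ht1) (hg2 t ht1) fun a ha b hb => lt_of_lt_of_le ?_ (H a b)
    calc t = t ^ l * t ^ (1 - l) := by rw [← Real.rpow_add ht]; simp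
      _ < f a ^ l * g b ^ (1 - l) := by
        have ha : t < f a := ha
        have hb : t < g b := hb
        gcongr
  · have e1 : {a | t < f a} = ∅ := by
      ext a; simpa using (hf1 a).trans ht1
    have e2 : {a | t < g a} = ∅ := by
      ext a; simpa using (hg1 a).trans ht1
    simp [e1, e2]

/-- The one-dimensional Prékopa-Leindler inequality for bounded functions. -/
lemma prekopa_leindler {f g h : ℝ → ℝ} {l : ℝ} (hl0 : 0 < l) (hl1 : l < 1)
    (hf : Measurable f) (hg : Measurable g) (hh : Measurable h)
    (hf0 : ∀ x, 0 ≤ f x) (hg0 : ∀ x, 0 ≤ g x) (hh0 : ∀ x, 0 ≤ h x)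
    (hfb : BddAbove (Set.range f)) (hgb : BddAbove (Set.range g))
    (H : ∀ x y, f x ^ l * g y ^ (1 - l) ≤ h (l * x + (1 - l) * y)) :
    (∫⁻ x, ENNReal.ofReal (f x)) ^ l * (∫⁻ x, ENNReal.ofReal (g x)) ^ (1 - l) ≤
      ∫⁻ x, ENNReal.ofReal (h x) := by
  have hl1' : 0 < 1 - l := sub_pos.2 hl1
  by_cases hfz : ∀ x, f x = 0
  · simp [hfz, hl0]
  by_cases hgz : ∀ x, g x = 0
  · simp [hgz, hl1]
  push Not at hfz hgz
  obtain ⟨p, hp⟩ := hfz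
  obtain ⟨q, hq⟩ := hgz
  set S := ⨆ x, f x with hS
  set T := ⨆ x, g x with hT
  have hS0 : 0 < S := lt_of_lt_of_le ((hf0 p).lt_of_ne' hp) (le_ciSup hfb p)
  have hT0 : 0 < T := lt_of_lt_of_le ((hg0 q).lt_of_ne' hq) (le_ciSup hgb q)
  have hc : 0 < S ^ l * T ^ (1 - l) := by positivity
  have scale : ∀ (k : ℝ → ℝ) (c : ℝ), 0 < c → Measurable k →
      ∫⁻ x, ENNReal.ofReal (k x) = ENNReal.ofReal c * ∫⁻ x, ENNReal.ofReal (k x / c) := by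
    intro k c hc hk
    rw [← lintegral_const_mul _ (by fun_prop)]
    refine lintegral_congr fun x => ?_
    rw [← ENNReal.ofReal_mul hc.le, mul_div_cancel₀ _ hc.ne']
  have main := prekopa_leindler_of_sup_eq_one (f := fun x => f x / S) (g := fun x => g x / T)
    (h := fun x => h x / (S ^ l * T ^ (1 - l))) hl0 hl1 (by fun_prop) (by fun_prop) (by fun_prop)
    (fun x => div_nonneg (hf0 x) hS0.le) (fun x => div_nonneg (hg0 x) hT0.le)
    (fun x => div_nonneg (hh0 x) hc.le)
    (fun x => (div_le_one hS0).2 (le_ciSup hfb x)) (fun x => (div_le_one hT0).2 (le_ciSup hgb x))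
    (fun t ht => by
      obtain ⟨x, hx⟩ := exists_lt_of_lt_ciSup (show t * S < ⨆ x, f x from by nlinarith)
      exact ⟨x, (lt_div_iff₀ hS0).2 hx⟩)
    (fun t ht => by
      obtain ⟨x, hx⟩ := exists_lt_of_lt_ciSup (show t * T < ⨆ x, g x from by nlinarith)
      exact ⟨x, (lt_div_iff₀ hT0).2 hx⟩)
    (fun x y => by
      rw [Real.div_rpow (hf0 x) hS0.le, Real.div_rpow (hg0 y) hT0.le, div_mul_div_comm]
      exact div_le_div_of_nonneg_right (H x y) hc.le)
  have main' := (ennreal_geom_mean_le_arith_mean hl0 hl1 _ _).trans main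
  rw [scale f S hS0 hf, scale g T hT0 hg, scale h _ hc hh,
    ENNReal.mul_rpow_of_nonneg _ _ hl0.le, ENNReal.mul_rpow_of_nonneg _ _ hl1'.le,
    mul_mul_mul_comm, ENNReal.ofReal_rpow_of_pos hS0, ENNReal.ofReal_rpow_of_pos hT0,
    ← ENNReal.ofReal_mul (by positivity)]
  gcongr

/-- The multiplicative Brunn-Minkowski inequality in `ℝⁿ`, for bounded measurable sets. -/
lemma volume_rpow_mul_volume_rpow_le {n : ℕ} {l : ℝ} (hl0 : 0 < l) (hl1 : l < 1)
    {A B C : Set (Fin n → ℝ)} (hA : MeasurableSet A) (hB : MeasurableSet B) (hC : MeasurableSet C)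
    (hAb : Bornology.IsBounded A) (hBb : Bornology.IsBounded B) (hCb : Bornology.IsBounded C)
    (H : ∀ a ∈ A, ∀ b ∈ B, l • a + (1 - l) • b ∈ C) :
    volume A ^ l * volume B ^ (1 - l) ≤ volume C := by
  have hl1' : 0 < 1 - l := sub_pos.2 hl1
  induction n with
  | zero =>
    rcases A.eq_empty_or_nonempty with rfl | ⟨a, ha⟩
    · simp [hl0]
    rcases B.eq_empty_or_nonempty with rfl | ⟨b, hb⟩
    · simp [hl1]
    have hCu : C = Set.univ := by
      ext x; simpa [Subsingleton.elim x (l • a + (1 - l) • b)] using H a ha b hb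
    have hle : ∀ D : Set (Fin 0 → ℝ), volume D ≤ 1 := fun D =>
      (measure_mono (Set.subset_univ D)).trans (by simp [volume_pi])
    have hCv : volume C = 1 := by rw [hCu]; simp [volume_pi]
    rw [hCv]
    exact mul_le_one' (ENNReal.rpow_le_one (hle A) hl0.le) (ENNReal.rpow_le_one (hle B) hl1'.le)
  | succ n ih =>
    let sec : Set (Fin (n + 1) → ℝ) → ℝ → Set (Fin n → ℝ) := fun D x => {z | Fin.cons x z ∈ D}
    have hcons : Measurable fun p : ℝ × (Fin n → ℝ) => (Fin.cons p.1 p.2 : Fin (n + 1) → ℝ) := by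
      refine measurable_pi_lambda _ fun i => ?_
      refine Fin.cases ?_ (fun j => ?_) i
      · simpa using measurable_fst
      · simpa [Function.comp_def] using (measurable_pi_apply j).comp measurable_snd
    have hsecm : ∀ D, MeasurableSet D → ∀ x, MeasurableSet (sec D x) := fun D hD x =>
      (hcons.comp (measurable_prodMk_left (x := x))) hD
    have hsecb : ∀ D, Bornology.IsBounded D → ∃ R, ∀ x, sec D x ⊆ closedBall 0 R := by
      intro D hD
      obtain ⟨R, hR⟩ := hD.subset_closedBall 0
      refine ⟨R, fun x z hz => ?_⟩
      have h1 := hR hz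
      rw [mem_closedBall_zero_iff] at h1 ⊢
      have hR0 : 0 ≤ R := (norm_nonneg _).trans h1
      rw [pi_norm_le_iff_of_nonneg hR0] at h1 ⊢
      exact fun i => by simpa using h1 i.succ
    have hvol : ∀ D, MeasurableSet D → Bornology.IsBounded D →
        volume D = ∫⁻ x, ENNReal.ofReal (volume (sec D x)).toReal := by
      intro D hD hDb
      have e := (volume_preserving_piFinSuccAbove (fun _ : Fin (n + 1) => ℝ) 0).symm
      rw [← e.measure_preimage hD.nullMeasurableSet, Measure.volume_eq_prod,
        Measure.prod_apply (e.measurable hD)]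
      refine lintegral_congr fun x => ?_
      obtain ⟨R, hR⟩ := hsecb D hDb
      rw [ENNReal.ofReal_toReal
        ((measure_mono (hR x)).trans_lt measure_closedBall_lt_top).ne]
      congr 1
      ext z
      simp [sec, MeasurableEquiv.piFinSuccAbove, Fin.insertNthEquiv]
    have hvm : ∀ D, MeasurableSet D → Measurable fun x => (volume (sec D x)).toReal := by
      intro D hD
      exact (measurable_measure_prodMk_left (hcons hD)).ennreal_toReal
    have hbdd : ∀ D, Bornology.IsBounded D →
        BddAbove (Set.range fun x => (volume (sec D x)).toReal) := by
      intro D hD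
      obtain ⟨R, hR⟩ := hsecb D hD
      refine ⟨(volume (closedBall (0 : Fin n → ℝ) R)).toReal, ?_⟩
      rintro _ ⟨x, rfl⟩
      exact ENNReal.toReal_mono measure_closedBall_lt_top.ne (measure_mono (hR x))
    rw [hvol A hA hAb, hvol B hB hBb, hvol C hC hCb]
    refine prekopa_leindler hl0 hl1 (hvm A hA) (hvm B hB) (hvm C hC) (by simp) (by simp) (by simp)
      (hbdd A hAb) (hbdd B hBb) fun x y => ?_
    have hsb : ∀ D, Bornology.IsBounded D → ∀ x, Bornology.IsBounded (sec D x) := by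
      intro D hD x
      obtain ⟨R, hR⟩ := hsecb D hD
      exact isBounded_closedBall.subset (hR x)
    have key := ih (hsecm A hA x) (hsecm B hB y) (hsecm C hC (l * x + (1 - l) * y))
      (hsb A hAb x) (hsb B hBb y) (hsb C hCb _) (by
        intro a ha b hb
        have := H _ ha _ hb
        change (Fin.cons _ _ : Fin (n + 1) → ℝ) ∈ C
        convert! this using 1
        ext i
        refine Fin.cases ?_ (fun j => ?_) i <;> simp)
    have := ENNReal.toReal_mono (hsb C hCb _).measure_lt_top.ne key
    rwa [ENNReal.toReal_mul, ← ENNReal.toReal_rpow, ← ENNReal.toReal_rpow] at this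

lemma euclidean_volume_rpow_mul_volume_rpow_le {n : ℕ} {l : ℝ} (hl0 : 0 < l) (hl1 : l < 1)
    {A B C : Set (EuclideanSpace ℝ (Fin n))} (hA : MeasurableSet A) (hB : MeasurableSet B)
    (hC : MeasurableSet C) (hAb : Bornology.IsBounded A) (hBb : Bornology.IsBounded B)
    (hCb : Bornology.IsBounded C) (H : ∀ a ∈ A, ∀ b ∈ B, l • a + (1 - l) • b ∈ C) :
    volume A ^ l * volume B ^ (1 - l) ≤ volume C := by
  have e := PiLp.volume_preserving_toLp (Fin n)
  have hb : ∀ D : Set (EuclideanSpace ℝ (Fin n)), Bornology.IsBounded D →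
      Bornology.IsBounded (WithLp.toLp 2 ⁻¹' D : Set (Fin n → ℝ)) := by
    intro D hD
    have := (EuclideanSpace.equiv (Fin n) ℝ).lipschitz.isBounded_image hD
    refine this.subset fun z hz => ⟨WithLp.toLp 2 z, hz, rfl⟩
  rw [← e.measure_preimage hA.nullMeasurableSet, ← e.measure_preimage hB.nullMeasurableSet,
    ← e.measure_preimage hC.nullMeasurableSet]
  exact volume_rpow_mul_volume_rpow_le hl0 hl1 (e.measurable hA) (e.measurable hB)
    (e.measurable hC) (hb A hAb) (hb B hBb) (hb C hCb) fun a ha b hb => H _ ha _ hb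

/-- The Brunn-Minkowski inequality, when one of the two summands is a ball. -/
lemma pow_le_volume_of_add_ball_subset {N : ℕ} (hN : N ≠ 0) {h : ℝ} (hh : 0 < h)
    {A C : Set (EuclideanSpace ℝ (Fin N))} (hA : MeasurableSet A) (hC : MeasurableSet C)
    (hAb : Bornology.IsBounded A) (hCb : Bornology.IsBounded C) (hA0 : volume A ≠ 0)
    (H : ∀ a ∈ A, ∀ b ∈ ball (0 : EuclideanSpace ℝ (Fin N)) h, a + b ∈ C) :
    (volume.real A ^ (N⁻¹ : ℝ) +
      h * volume.real (ball (0 : EuclideanSpace ℝ (Fin N)) 1) ^ (N⁻¹ : ℝ)) ^ N ≤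
      volume.real C := by
  have hfr : Module.finrank ℝ (EuclideanSpace ℝ (Fin N)) = N := finrank_euclideanSpace_fin
  set V := volume.real A with hV
  set w := volume.real (ball (0 : EuclideanSpace ℝ (Fin N)) 1) with hw
  have hV0 : 0 < V := ENNReal.toReal_pos hA0 hAb.measure_lt_top.ne
  have hw0 : 0 < w := ENNReal.toReal_pos (measure_ball_pos _ _ one_pos).ne' measure_ball_lt_top.ne
  set a := V ^ (N⁻¹ : ℝ) with ha
  set b := h * w ^ (N⁻¹ : ℝ) with hb
  have ha0 : 0 < a := by positivity
  have hb0 : 0 < b := by positivity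
  have haN : a ^ N = V := Real.rpow_inv_natCast_pow hV0.le hN
  have hbN : b ^ N = h ^ N * w := by rw [hb, mul_pow, Real.rpow_inv_natCast_pow hw0.le hN]
  set l := a / (a + b) with hl
  have hl0 : 0 < l := by positivity
  have hl' : 1 - l = b / (a + b) := by rw [hl]; field_simp; ring
  have hl0' : 0 < 1 - l := by rw [hl']; positivity
  have key := euclidean_volume_rpow_mul_volume_rpow_le (A := l⁻¹ • A)
    (B := (1 - l)⁻¹ • ball (0 : EuclideanSpace ℝ (Fin N)) h) (C := C) hl0 (sub_pos.1 hl0')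
    (hA.const_smul₀ _) (measurableSet_ball.const_smul₀ _) hC (hAb.smul₀ _)
    (isBounded_ball.smul₀ _) hCb (by
      rintro _ ⟨x, hx, rfl⟩ _ ⟨y, hy, rfl⟩
      simpa [smul_smul, hl0.ne', hl0'.ne'] using H x hx y hy)
  have h1 : volume (l⁻¹ • A) = ENNReal.ofReal ((a + b) ^ N) := by
    rw [Measure.addHaar_smul, hfr, ← ofReal_measureReal hAb.measure_lt_top.ne, ← hV,
      ← ENNReal.ofReal_mul (abs_nonneg _), abs_of_pos (by positivity), ← haN, hl, ← mul_pow]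
    congr 2; field_simp
  have h2 : volume ((1 - l)⁻¹ • ball (0 : EuclideanSpace ℝ (Fin N)) h) =
      ENNReal.ofReal ((a + b) ^ N) := by
    rw [Measure.addHaar_smul, hfr, Measure.addHaar_ball_of_pos _ _ hh, hfr,
      ← ofReal_measureReal (s := ball (0 : EuclideanSpace ℝ (Fin N)) 1) measure_ball_lt_top.ne,
      ← hw, ← ENNReal.ofReal_mul (by positivity), ← hbN,
      ← ENNReal.ofReal_mul (abs_nonneg _), abs_of_pos (by positivity), hl', ← mul_pow]
    congr 2; field_simp
  rw [h1, h2, ← ENNReal.rpow_add _ _ (by simp; positivity) ENNReal.ofReal_ne_top] at key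
  simp only [add_sub_cancel, ENNReal.rpow_one] at key
  exact (ENNReal.ofReal_le_iff_le_toReal hCb.measure_lt_top.ne).1 key

/-- Linearized Brunn-Minkowski inequality: a lower bound for the volume of a neighbourhood. -/
lemma volume_add_le_volume_of_add_ball_subset {N : ℕ} (hN : N ≠ 0) {h : ℝ} (hh : 0 < h)
    {A C : Set (EuclideanSpace ℝ (Fin N))} (hA : MeasurableSet A) (hC : MeasurableSet C)
    (hAb : Bornology.IsBounded A) (hCb : Bornology.IsBounded C) (hA0 : volume A ≠ 0)
    (H : ∀ a ∈ A, ∀ b ∈ ball (0 : EuclideanSpace ℝ (Fin N)) h, a + b ∈ C) :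
    volume.real A + N * h * volume.real (ball (0 : EuclideanSpace ℝ (Fin N)) 1) ^ (N⁻¹ : ℝ) *
      volume.real A ^ (1 - (N⁻¹ : ℝ)) ≤ volume.real C := by
  refine le_trans ?_ (pow_le_volume_of_add_ball_subset hN hh hA hC hAb hCb hA0 H)
  have hV0 : 0 < volume.real A := ENNReal.toReal_pos hA0 hAb.measure_lt_top.ne
  set a := volume.real A ^ (N⁻¹ : ℝ) with ha
  set b := h * volume.real (ball (0 : EuclideanSpace ℝ (Fin N)) 1) ^ (N⁻¹ : ℝ) with hb
  have ha0 : 0 < a := by positivity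
  have hb0 : 0 ≤ b := by positivity
  have haN : a ^ N = volume.real A := Real.rpow_inv_natCast_pow hV0.le hN
  have h1 : volume.real A ^ (1 - (N⁻¹ : ℝ)) = volume.real A / a := by
    rw [Real.rpow_sub hV0, Real.rpow_one]
  have hB := one_add_mul_le_pow (a := b / a) (by have : 0 ≤ b / a := by positivity
                                                 linarith) N
  calc _ = a ^ N * (1 + N * (b / a)) := by rw [h1, haN, hb]; ring
    _ ≤ a ^ N * (1 + b / a) ^ N := by gcongr
    _ = (a + b) ^ N := by rw [← mul_pow]; congr 1; field_simp

/-- The sharp isoperimetric inequality, in functional form. -/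
lemma isoperimetric_integral_norm_fderiv {N : ℕ} (hN : 2 ≤ N)
    {f : EuclideanSpace ℝ (Fin N) → ℝ} (hf : ContDiff ℝ 1 f) (hfc : HasCompactSupport f)
    (hf0 : ∀ x, 0 ≤ f x) {m : ℝ} (hm : 0 < m) {T : Set (EuclideanSpace ℝ (Fin N))}
    (hT : ∀ x ∈ T, m ≤ f x) :
    N * volume.real (ball (0 : EuclideanSpace ℝ (Fin N)) 1) ^ (N⁻¹ : ℝ) * m *
      volume.real T ^ (1 - (N⁻¹ : ℝ)) ≤ ∫ x, ‖fderiv ℝ f x‖ := by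
  have hN0 : N ≠ 0 := by omega
  have hN1 : 0 < 1 - (N⁻¹ : ℝ) := by
    have : (2 : ℝ) ≤ N := by exact_mod_cast hN
    rw [sub_pos]; exact inv_lt_one_of_one_lt₀ (by linarith)
  by_cases hT0 : volume T = 0
  · have hTr : volume.real T = 0 := by rw [Measure.real, hT0, ENNReal.toReal_zero]
    simp only [hTr, Real.zero_rpow hN1.ne', mul_zero]
    exact integral_nonneg fun x => norm_nonneg _
  set w := volume.real (ball (0 : EuclideanSpace ℝ (Fin N)) 1) ^ (N⁻¹ : ℝ) with hw
  have hw0 : 0 ≤ w := by positivity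
  have hdc : Continuous (fderiv ℝ f) := hf.continuous_fderiv one_ne_zero
  have hdcs : HasCompactSupport (fderiv ℝ f) := hfc.fderiv ℝ
  have hfi : Integrable f := hf.continuous.integrable_of_hasCompactSupport hfc
  have hdi : Integrable fun x => ‖fderiv ℝ f x‖ :=
    (hdc.integrable_of_hasCompactSupport hdcs).norm
  set K := cthickening 1 (tsupport f) with hK
  have hKc : IsCompact K := hfc.isCompact.cthickening
  have hKm : MeasurableSet K := hKc.measurableSet
  have main : ∀ ε > 0, N * w * m * volume.real T ^ (1 - (N⁻¹ : ℝ)) ≤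
      (∫ x, ‖fderiv ℝ f x‖) + ε * volume.real K := by
    intro ε hε
    obtain ⟨δ, hδ, hδ'⟩ := Metric.uniformContinuous_iff.1
      (hdcs.uniformContinuous_of_continuous hdc) ε hε
    set h := min δ 1 with hh
    have hh0 : 0 < h := lt_min hδ one_pos
    set k : EuclideanSpace ℝ (Fin N) → ℝ := K.indicator fun x => h * (‖fderiv ℝ f x‖ + ε) with hk
    have hk0 : ∀ x, 0 ≤ k x := fun x => Set.indicator_nonneg (fun y _ => by positivity) x
    have hki : Integrable k := by
      refine IntegrableOn.integrable_indicator ?_ hKm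
      exact ((hdi.integrableOn.add (integrableOn_const hKc.measure_lt_top.ne)).const_mul h)
    have hkle : ∫ x, k x ≤ h * ((∫ x, ‖fderiv ℝ f x‖) + ε * volume.real K) := by
      rw [hk, integral_indicator hKm, integral_const_mul, integral_add hdi.integrableOn
        (integrableOn_const hKc.measure_lt_top.ne), setIntegral_const, smul_eq_mul, mul_comm ε]
      gcongr
      · exact .of_forall fun x => norm_nonneg _
      · exact Measure.restrict_le_self
    set c := N * h * w * volume.real T ^ (1 - (N⁻¹ : ℝ)) with hc
    have hc0 : 0 ≤ c := by positivity
    have hgm : Measurable fun x => f x + k x :=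
      hf.continuous.measurable.add ((by fun_prop : Measurable _).indicator hKm)
    have hfK : ∀ t, 0 ≤ t → {x | t < f x} ⊆ tsupport f := fun t ht x hx =>
      subset_tsupport f (ht.trans_lt hx).ne'
    have htK : tsupport f ⊆ K := self_subset_cthickening _
    have hgK : ∀ t, 0 ≤ t → {x | t < f x + k x} ⊆ K := by
      intro t ht x hx
      by_contra hxK
      have h1 : k x = 0 := Set.indicator_of_notMem hxK _
      have h2 : f x = 0 := image_eq_zero_of_notMem_tsupport fun h => hxK (htK h)
      simp only [Set.mem_ofPred_eq, h1, h2] at hx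
      linarith
    have hnear : ∀ x ∈ tsupport f, ∀ y ∈ ball (0 : EuclideanSpace ℝ (Fin N)) h,
        f x ≤ f (x + y) + k (x + y) := by
      intro x hx y hy
      rw [mem_ball_zero_iff] at hy
      have hz : x + y ∈ K := by
        refine mem_cthickening_of_dist_le _ x 1 _ hx ?_
        simpa using hy.le.trans (min_le_right _ _)
      have hmv := (convex_ball (x + y) h).norm_image_sub_le_of_norm_fderiv_le (𝕜 := ℝ) (f := f)
        (C := ‖fderiv ℝ f (x + y)‖ + ε) (x := x + y) (y := x)
        (fun p _ => (hf.differentiable one_ne_zero) p) (fun p hp => by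
          have h1 := hδ' (lt_of_lt_of_le (mem_ball.1 hp) (min_le_left _ _))
          rw [dist_eq_norm] at h1
          have h2 := norm_le_norm_add_norm_sub' (fderiv ℝ f p) (fderiv ℝ f (x + y))
          linarith) (mem_ball_self hh0) (by simpa [dist_eq_norm] using hy)
      have h3 : ‖x - (x + y)‖ ≤ h := by simpa using hy.le
      have h4 : (‖fderiv ℝ f (x + y)‖ + ε) * ‖x - (x + y)‖ ≤ h * (‖fderiv ℝ f (x + y)‖ + ε) := by
        rw [mul_comm]; gcongr
      rw [hk, Set.indicator_of_mem hz]
      have h5 := (Real.le_norm_self _).trans hmv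
      linarith
    have hlevel : ∀ t ∈ Set.Ioi (0 : ℝ), volume {x | t < f x} +
        (Set.Ioo 0 m).indicator (fun _ => ENNReal.ofReal c) t ≤ volume {x | t < f x + k x} := by
      intro t (ht : 0 < t)
      by_cases htm : t < m
      · rw [Set.indicator_of_mem (show t ∈ Set.Ioo 0 m from ⟨ht, htm⟩)]
        have hTs : T ⊆ {x | t < f x} := fun x hx => htm.trans_le (hT x hx)
        have hAb : Bornology.IsBounded {x | t < f x} := hfc.isCompact.isBounded.subset (hfK t ht.le)
        have hCb : Bornology.IsBounded {x | t < f x + k x} := hKc.isBounded.subset (hgK t ht.le)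
        have hbm := volume_add_le_volume_of_add_ball_subset hN0 hh0
          (hf.continuous.measurable measurableSet_Ioi) (hgm measurableSet_Ioi) hAb hCb
          (fun h0 => hT0 (measure_mono_null hTs h0))
          (fun x hx y hy => lt_of_lt_of_le hx (hnear x (hfK t ht.le hx) y hy))
        rw [← hw] at hbm
        have hbm' : volume.real {x | t < f x} + c ≤ volume.real {x | t < f x + k x} := by
          refine le_trans ?_ hbm
          change _ ≤ volume.real {x | t < f x} + _
          rw [hc]
          gcongr
          · exact hAb.measure_lt_top.ne
          · exact hTs
        rw [← ofReal_measureReal hAb.measure_lt_top.ne, ← ofReal_measureReal hCb.measure_lt_top.ne,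
          ← ENNReal.ofReal_add measureReal_nonneg hc0]
        exact ENNReal.ofReal_le_ofReal hbm'
      · rw [Set.indicator_of_notMem (fun h => htm h.2), add_zero]
        exact measure_mono fun x (hx : t < f x) => hx.trans_le (by linarith [hk0 x])
    have hmeas : ∀ p : EuclideanSpace ℝ (Fin N) → ℝ,
        Measurable fun t : ℝ => volume {a | t < p a} := fun p =>
      Antitone.measurable fun s t hst => measure_mono fun a ha => lt_of_le_of_lt hst ha
    have hlayer := setLIntegral_mono (μ := volume) (hmeas fun x => f x + k x) hlevel
    rw [lintegral_add_left (hmeas f), ← lintegral_eq_lintegral_meas_lt _ (.of_forall hf0)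
      hf.continuous.aemeasurable, ← lintegral_eq_lintegral_meas_lt _
      (.of_forall fun x => add_nonneg (hf0 x) (hk0 x)) hgm.aemeasurable,
      lintegral_indicator measurableSet_Ioo, setLIntegral_const,
      Measure.restrict_apply measurableSet_Ioo, Set.inter_eq_left.2 Set.Ioo_subset_Ioi_self,
      Real.volume_Ioo, sub_zero, ← ofReal_integral_eq_lintegral_ofReal hfi (.of_forall hf0),
      ← ofReal_integral_eq_lintegral_ofReal (f := fun x => f x + k x) (hfi.add hki)
        (.of_forall fun x => add_nonneg (hf0 x) (hk0 x)),
      ← ENNReal.ofReal_mul hc0, ← ENNReal.ofReal_add (integral_nonneg hf0) (by positivity),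
      ENNReal.ofReal_le_ofReal_iff (integral_nonneg fun x => add_nonneg (hf0 x) (hk0 x)),
      integral_add hfi hki] at hlayer
    have hfin : h * (N * w * m * volume.real T ^ (1 - (N⁻¹ : ℝ))) ≤
        h * ((∫ x, ‖fderiv ℝ f x‖) + ε * volume.real K) := by
      have : c * m = h * (N * w * m * volume.real T ^ (1 - (N⁻¹ : ℝ))) := by rw [hc]; ring
      linarith
    exact le_of_mul_le_mul_left hfin hh0
  refine le_of_forall_pos_le_add fun η hη => ?_
  refine (main (η / (volume.real K + 1)) (by positivity)).trans ?_
  gcongr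
  rw [div_mul_eq_mul_div, div_le_iff₀ (by positivity)]
  nlinarith [measureReal_nonneg (μ := volume) (s := K)]

lemma norm_sq_eq_sum_apply_single_sq {N : ℕ} (L : EuclideanSpace ℝ (Fin N) →L[ℝ] ℝ) :
    ‖L‖ ^ 2 = ∑ i, (L (EuclideanSpace.single i 1)) ^ 2 := by
  obtain ⟨y, rfl⟩ := (InnerProductSpace.toDual ℝ (EuclideanSpace ℝ (Fin N))).surjective L
  simp [EuclideanSpace.norm_sq_eq, EuclideanSpace.inner_single_right]

/-- Energy identity: test `Δw = -N` against a function `φ ∘ w` supported where `w > s`. -/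
lemma integral_mul_norm_fderiv_sq_eq {N : ℕ} {w : EuclideanSpace ℝ (Fin N) → ℝ}
    (hw : ContDiff ℝ 2 w) (hwc : HasCompactSupport w) {s : ℝ} (hs : 0 ≤ s)
    (hlap : ∀ x, s < w x → lap w x = -N) {φ a : ℝ → ℝ} (ha : Continuous a)
    (hφ : ∀ x, HasDerivAt φ (a x) x) (hφs : ∀ x ≤ s, φ x = 0) (has : ∀ x ≤ s, a x = 0) :
    ∫ x, a (w x) * ‖fderiv ℝ w x‖ ^ 2 = N * ∫ x, φ (w x) := by
  have hφc : Continuous φ := continuous_iff_continuousAt.2 fun x => (hφ x).continuousAt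
  have hdw : ContDiff ℝ 1 (fderiv ℝ w) := hw.fderiv_right (m := 1) (by norm_num)
  have hdwc := hdw.continuous
  have hddwc : Continuous (fderiv ℝ (fderiv ℝ w)) := hdw.continuous_fderiv one_ne_zero
  have hwd : Differentiable ℝ w := hw.differentiable (by norm_num)
  have hP : ∀ x, HasFDerivAt (fun x => φ (w x)) (a (w x) • fderiv ℝ w x) x := fun x =>
    (hφ (w x)).comp_hasFDerivAt x (hwd x).hasFDerivAt
  have hPc : HasCompactSupport fun x => φ (w x) := hwc.comp_left (g := φ) (hφs 0 hs)
  have hac : HasCompactSupport fun x => a (w x) := hwc.comp_left (g := a) (has 0 hs)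
  let e : Fin N → EuclideanSpace ℝ (Fin N) := fun i => EuclideanSpace.single i 1
  have hQ : ∀ i x, HasFDerivAt (fun x => fderiv ℝ w x (e i))
      ((fderiv ℝ (fderiv ℝ w) x).flip (e i)) x := fun i x => by
    have := ((hdw.differentiable one_ne_zero x).hasFDerivAt).clm_apply
      (hasFDerivAt_const (e i) x)
    simpa using this
  have hi1 : ∀ i, Integrable fun x => a (w x) * (fderiv ℝ w x (e i)) ^ 2 := fun i =>
    Continuous.integrable_of_hasCompactSupport (by fun_prop) hac.mul_right
  have hi2 : ∀ i, Integrable fun x => φ (w x) * fderiv ℝ (fderiv ℝ w) x (e i) (e i) := fun i =>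
    Continuous.integrable_of_hasCompactSupport (by fun_prop) hPc.mul_right
  have hi3 : ∀ i, Integrable fun x => φ (w x) * fderiv ℝ w x (e i) := fun i =>
    Continuous.integrable_of_hasCompactSupport (by fun_prop) hPc.mul_right
  have hparts : ∀ i, ∫ x, a (w x) * (fderiv ℝ w x (e i)) ^ 2 =
      - ∫ x, φ (w x) * fderiv ℝ (fderiv ℝ w) x (e i) (e i) := by
    intro i
    have := integral_mul_fderiv_eq_neg_fderiv_mul_of_integrable (μ := volume)
      (f := fun x => φ (w x)) (g := fun x => fderiv ℝ w x (e i)) (v := e i)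
      (by simpa [(hP _).fderiv, mul_assoc, sq] using hi1 i)
      (by simpa [(hQ i _).fderiv] using hi2 i) (hi3 i)
      (fun x _ => (hP x).differentiableAt) (fun x _ => (hQ i x).differentiableAt)
    simp only [(hP _).fderiv, (hQ i _).fderiv, ContinuousLinearMap.flip_apply,
      smul_apply, smul_eq_mul, mul_assoc, ← sq] at this
    linarith
  calc ∫ x, a (w x) * ‖fderiv ℝ w x‖ ^ 2
      = ∑ i, ∫ x, a (w x) * (fderiv ℝ w x (e i)) ^ 2 := by
        rw [← integral_finsetSum _ fun i _ => hi1 i]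
        simp only [norm_sq_eq_sum_apply_single_sq, Finset.mul_sum, e]
    _ = - ∫ x, ∑ i, φ (w x) * fderiv ℝ (fderiv ℝ w) x (e i) (e i) := by
        rw [integral_finsetSum _ fun i _ => hi2 i, ← Finset.sum_neg_distrib]
        exact Finset.sum_congr rfl fun i _ => hparts i
    _ = N * ∫ x, φ (w x) := by
        rw [← integral_neg, ← integral_const_mul]
        refine integral_congr_ae (.of_forall fun x => ?_)
        simp only [← Finset.mul_sum]
        rcases le_or_gt (w x) s with hx | hx
        · simp [hφs _ hx]
        · have := hlap x hx
          simp only [lap, iteratedFDeriv_two_apply, Matrix.cons_val_zero, Matrix.cons_val_one]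
            at this
          rw [this]; ring

/-- Cauchy-Schwarz and the isoperimetric inequality applied to a truncation `φ ∘ w`. -/
lemma level_set_estimate_of_truncation {N : ℕ} (hN : 2 ≤ N) {w : EuclideanSpace ℝ (Fin N) → ℝ}
    (hw : ContDiff ℝ 2 w) (hwc : HasCompactSupport w) {s t m : ℝ} (hs : 0 < s)
    (hlap : ∀ x, s < w x → lap w x = -N) {φ a : ℝ → ℝ} (ha : Continuous a)
    (hφ : ∀ x, HasDerivAt φ (a x) x) (hφs : ∀ x ≤ s, φ x = 0) (has : ∀ x ≤ s, a x = 0)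
    (hφt : ∀ x ≥ t, φ x = m) (hat : ∀ x ≥ t, a x = 0) (ha0 : ∀ x, 0 ≤ a x) (ha1 : ∀ x, a x ≤ 1)
    (hm : 0 < m) :
    N * m * volume.real (ball (0 : EuclideanSpace ℝ (Fin N)) 1) ^ (2 / N : ℝ) *
      volume.real {x | t ≤ w x} ^ (2 - 2 / N : ℝ) ≤
      (volume.real {x | s ≤ w x} - volume.real {x | t ≤ w x}) * volume.real {x | s ≤ w x} := by
  have hN0 : (0 : ℝ) < N := by exact_mod_cast (by omega : 0 < N)
  have hφc : Continuous φ := continuous_iff_continuousAt.2 fun x => (hφ x).continuousAt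
  have hφm : Monotone φ := monotone_of_hasDerivAt_nonneg hφ ha0
  have hst : s ≤ t := by
    by_contra! h
    linarith [hφs s le_rfl, hφt s h.le]
  have hφ0 : ∀ x, 0 ≤ φ x := fun x => by
    rcases le_total x s with h | h
    · exact (hφs x h).ge
    · exact (hφs s le_rfl).ge.trans (hφm h)
  have hφle : ∀ x, φ x ≤ m := fun x => by
    rcases le_total x t with h | h
    · exact (hφm h).trans (hφt t le_rfl).le
    · exact (hφt x h).le
  have hdwc : Continuous (fderiv ℝ w) := hw.continuous_fderiv (by norm_num)
  have hP : ∀ x, HasFDerivAt (fun x => φ (w x)) (a (w x) • fderiv ℝ w x) x := fun x =>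
    (hφ (w x)).comp_hasFDerivAt x (hw.differentiable (by norm_num) x).hasFDerivAt
  have hPc : HasCompactSupport fun x => φ (w x) := hwc.comp_left (g := φ) (hφs 0 hs.le)
  have hac : HasCompactSupport fun x => a (w x) := hwc.comp_left (g := a) (has 0 hs.le)
  have hPd : fderiv ℝ (fun x => φ (w x)) = fun x => a (w x) • fderiv ℝ w x :=
    funext fun x => (hP x).fderiv
  have hPC : ContDiff ℝ 1 fun x => φ (w x) := by
    rw [contDiff_one_iff_fderiv]
    exact ⟨fun x => (hP x).differentiableAt, by rw [hPd]; fun_prop⟩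
  have hwcont := hw.continuous
  have hfin : ∀ r > 0, volume {x | r ≤ w x} ≠ ∞ := fun r hr =>
    (hwc.isCompact.measure_lt_top.trans_le' (measure_mono fun x (hx : r ≤ w x) =>
      subset_tsupport w (by simp only [Function.mem_support]; linarith))).ne
  have hmeas : ∀ r, MeasurableSet {x | r ≤ w x} := fun r =>
    (isClosed_le continuous_const hwcont).measurableSet
  have iso := isoperimetric_integral_norm_fderiv hN hPC hPc (fun x => hφ0 _) hm
    (T := {x | t ≤ w x}) (fun x hx => (hφt _ hx).ge)
  simp only [hPd, norm_smul, Real.norm_of_nonneg (ha0 _)] at iso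
  have energy := integral_mul_norm_fderiv_sq_eq hw hwc hs.le hlap ha hφ hφs has
  set ω := volume.real (ball (0 : EuclideanSpace ℝ (Fin N)) 1) with hω
  have hω0 : 0 ≤ ω := measureReal_nonneg
  set X := volume.real {x | s ≤ w x} with hX
  set Y := volume.real {x | t ≤ w x} with hY
  have hY0 : 0 ≤ Y := measureReal_nonneg
  have hX0 : 0 ≤ X := measureReal_nonneg
  set R := ∫ x, a (w x) * ‖fderiv ℝ w x‖
  set Q := ∫ x, a (w x) * ‖fderiv ℝ w x‖ ^ 2
  have iP : Integrable fun x => a (w x) :=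
    Continuous.integrable_of_hasCompactSupport (by fun_prop) hac
  have iR : Integrable fun x => a (w x) * ‖fderiv ℝ w x‖ :=
    Continuous.integrable_of_hasCompactSupport (by fun_prop) hac.mul_right
  have iQ : Integrable fun x => a (w x) * ‖fderiv ℝ w x‖ ^ 2 :=
    Continuous.integrable_of_hasCompactSupport (by fun_prop) hac.mul_right
  have hCS : R ^ 2 ≤ (∫ x, a (w x)) * Q := by
    have hd := discrim_le_zero (a := ∫ x, a (w x)) (b := -2 * R) (c := Q) fun k => by
      have h0 : 0 ≤ ∫ x, a (w x) * (k - ‖fderiv ℝ w x‖) ^ 2 :=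
        integral_nonneg fun x => mul_nonneg (ha0 _) (sq_nonneg _)
      have h1 : ∫ x, a (w x) * (k - ‖fderiv ℝ w x‖) ^ 2 =
          ∫ x, ((k * k) * a (w x) + (-2 * k) * (a (w x) * ‖fderiv ℝ w x‖) +
            a (w x) * ‖fderiv ℝ w x‖ ^ 2) :=
        integral_congr_ae (.of_forall fun x => by ring)
      rw [h1, integral_add (f := fun x => (k * k) * a (w x) + (-2 * k) * (a (w x) * ‖fderiv ℝ w x‖))
        ((iP.const_mul _).add (iR.const_mul _)) iQ,
        integral_add (iP.const_mul _) (iR.const_mul _), integral_const_mul,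
        integral_const_mul] at h0
      linarith
    rw [discrim] at hd
    linarith
  have hPle : ∫ x, a (w x) ≤ X - Y := by
    have hsub : {x | t ≤ w x} ⊆ {x | s ≤ w x} := fun x (hx : t ≤ w x) => hst.trans hx
    rw [hX, hY, ← measureReal_sdiff hsub (hmeas t) (hfin s hs),
      ← integral_indicator_one ((hmeas s).diff (hmeas t))]
    refine integral_mono iP ?_ fun x => ?_
    · exact (integrable_indicator_iff ((hmeas s).diff (hmeas t))).2
        (integrableOn_const ((measure_mono Set.sdiff_subset).trans_lt (hfin s hs).lt_top).ne)
    · by_cases hx : x ∈ {x | s ≤ w x} \ {x | t ≤ w x}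
      · rw [Set.indicator_of_mem hx]; exact ha1 _
      · rw [Set.indicator_of_notMem hx]
        by_cases h : s ≤ w x
        · exact (hat _ (by by_contra h'; exact hx ⟨h, h'⟩)).le
        · exact (has _ (le_of_not_ge h)).le
  have hQle : ∫ x, φ (w x) ≤ m * X := by
    rw [mul_comm, hX, ← smul_eq_mul, ← integral_indicator_const m (hmeas s)]
    refine integral_mono (hPC.continuous.integrable_of_hasCompactSupport hPc) ?_ fun x => ?_
    · exact (integrable_indicator_iff (hmeas s)).2 (integrableOn_const (hfin s hs))
    · by_cases hx : s ≤ w x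
      · rw [Set.indicator_of_mem (show x ∈ {x | s ≤ w x} from hx)]; exact hφle _
      · rw [Set.indicator_of_notMem (show x ∉ {x | s ≤ w x} from hx)]
        exact (hφs _ (le_of_not_ge hx)).le
  have hXY : 0 ≤ X - Y := (integral_nonneg fun x => ha0 _).trans hPle
  have hsq : (N * ω ^ (N⁻¹ : ℝ) * m * Y ^ (1 - (N⁻¹ : ℝ))) ^ 2 ≤ (X - Y) * (N * (m * X)) := by
    calc _ ≤ R ^ 2 := by gcongr
      _ ≤ (∫ x, a (w x)) * Q := hCS
      _ ≤ (X - Y) * (N * (m * X)) := by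
        rw [energy]
        gcongr
        exact mul_nonneg hN0.le (integral_nonneg fun x => hφ0 _)
  have e1 : (ω ^ (N⁻¹ : ℝ)) ^ 2 = ω ^ (2 / N : ℝ) := by
    rw [← Real.rpow_mul_natCast hω0]; congr 1; push_cast; ring
  have e2 : (Y ^ (1 - (N⁻¹ : ℝ))) ^ 2 = Y ^ (2 - 2 / N : ℝ) := by
    rw [← Real.rpow_mul_natCast hY0]; congr 1; push_cast; ring
  rw [mul_pow, mul_pow, mul_pow, e1, e2] at hsq
  refine le_of_mul_le_mul_left (a := N * m) ?_ (by positivity)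
  linarith

/-- The finite-difference form of Talenti's differential inequality for the distribution
function of `w`. -/
lemma level_set_estimate {N : ℕ} (hN : 2 ≤ N) {w : EuclideanSpace ℝ (Fin N) → ℝ}
    (hw : ContDiff ℝ 2 w) (hwc : HasCompactSupport w) {s t : ℝ} (hs : 0 < s) (hst : s < t)
    (hlap : ∀ x, s < w x → lap w x = -N) :
    N * (t - s) * volume.real (ball (0 : EuclideanSpace ℝ (Fin N)) 1) ^ (2 / N : ℝ) *
      volume.real {x | t ≤ w x} ^ (2 - 2 / N : ℝ) ≤
      (volume.real {x | s ≤ w x} - volume.real {x | t ≤ w x}) * volume.real {x | s ≤ w x} := by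
  have main : ∀ η > 0, 2 * η < t - s →
      N * (t - s - 2 * η) * volume.real (ball (0 : EuclideanSpace ℝ (Fin N)) 1) ^ (2 / N : ℝ) *
      volume.real {x | t ≤ w x} ^ (2 - 2 / N : ℝ) ≤
      (volume.real {x | s ≤ w x} - volume.real {x | t ≤ w x}) * volume.real {x | s ≤ w x} := by
    intro η hη hηt
    let a : ℝ → ℝ := fun x => max 0 (min 1 (min ((x - s) / η) ((t - x) / η)))
    have hac : Continuous a := by fun_prop
    have ha0 : ∀ x, 0 ≤ a x := fun x => le_max_left _ _
    have ha1 : ∀ x, a x ≤ 1 := fun x => max_le zero_le_one (min_le_left _ _)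
    have has : ∀ x ≤ s, a x = 0 := fun x hx => max_eq_left <|
      (min_le_right _ _).trans <| (min_le_left _ _).trans <|
        div_nonpos_of_nonpos_of_nonneg (by linarith) hη.le
    have hat : ∀ x ≥ t, a x = 0 := fun x hx => max_eq_left <|
      (min_le_right _ _).trans <| (min_le_right _ _).trans <|
        div_nonpos_of_nonpos_of_nonneg (by linarith) hη.le
    have hamid : ∀ x ∈ Set.Icc (s + η) (t - η), 1 ≤ a x := fun x hx =>
      le_max_of_le_right <| le_min le_rfl <| le_min ((one_le_div hη).2 (by linarith [hx.1]))
        ((one_le_div hη).2 (by linarith [hx.2]))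
    have hii : ∀ p q : ℝ, IntervalIntegrable a volume p q := fun p q => hac.intervalIntegrable p q
    let φ : ℝ → ℝ := fun x => ∫ y in s..x, a y
    have hφ : ∀ x, HasDerivAt φ (a x) x := fun x =>
      intervalIntegral.integral_hasDerivAt_right (hii s x)
        (hac.stronglyMeasurableAtFilter _ _) hac.continuousAt
    have hzero : ∀ p q : ℝ, (∀ y ∈ Set.uIcc p q, a y = 0) → ∫ y in p..q, a y = 0 := by
      intro p q h
      rw [intervalIntegral.integral_congr (g := fun _ => (0 : ℝ)) h]
      simp
    have hφs : ∀ x ≤ s, φ x = 0 := fun x hx => hzero _ _ fun y hy => has y (by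
      rw [Set.uIcc_of_ge hx] at hy; exact hy.2)
    have hφt : ∀ x ≥ t, φ x = φ t := fun x hx => by
      have h0 := hzero t x fun y hy => hat y (by rw [Set.uIcc_of_le hx] at hy; exact hy.1)
      have := intervalIntegral.integral_add_adjacent_intervals (hii s t) (hii t x)
      simp only [φ]
      linarith
    have hm : t - s - 2 * η ≤ φ t := by
      calc t - s - 2 * η = ∫ y in (s + η)..(t - η), (1 : ℝ) := by simp; ring
        _ ≤ ∫ y in (s + η)..(t - η), a y :=
          intervalIntegral.integral_mono_on (by linarith) (by simp) (hii _ _) hamid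
        _ ≤ φ t := intervalIntegral.integral_mono_interval (by linarith) (by linarith)
          (by linarith) (.of_forall ha0) (hii _ _)
    refine le_trans ?_ (level_set_estimate_of_truncation hN hw hwc hs hlap hac hφ hφs has hφt hat
      ha0 ha1 (by linarith))
    gcongr
  have hlim : Filter.Tendsto (fun η : ℝ => N * (t - s - 2 * η) *
      volume.real (ball (0 : EuclideanSpace ℝ (Fin N)) 1) ^ (2 / N : ℝ) *
      volume.real {x | t ≤ w x} ^ (2 - 2 / N : ℝ)) (nhdsWithin 0 (Set.Ioi 0))
      (nhds (N * (t - s - 2 * 0) *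
      volume.real (ball (0 : EuclideanSpace ℝ (Fin N)) 1) ^ (2 / N : ℝ) *
      volume.real {x | t ≤ w x} ^ (2 - 2 / N : ℝ))) :=
    (Continuous.tendsto (by fun_prop) 0).mono_left nhdsWithin_le_nhds
  rw [mul_zero, sub_zero] at hlim
  refine le_of_tendsto hlim ?_
  filter_upwards [Ioo_mem_nhdsGT (show (0 : ℝ) < (t - s) / 2 by linarith)] with η hη
  exact main η hη.1 (by linarith [hη.2])

/-- Integration of the differential inequality `c ≤ -μ' μ ^ (p - 1)` for a left-continuous
nonincreasing function, from its finite-difference form. -/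
lemma mul_sub_le_rpow_of_antitone {μ : ℝ → ℝ} {p c a b : ℝ} (hp0 : 0 < p) (hp1 : p ≤ 1)
    (hc : 0 < c) (hab : a ≤ b) (hμ : AntitoneOn μ (Set.Icc a b)) (hb : 0 < μ b)
    (hleft : ∀ t ∈ Set.Ioc a b, ∀ η > 0, ∃ s ∈ Set.Ico a t, μ s < μ t + η)
    (hdiff : ∀ s ∈ Set.Icc a b, ∀ t ∈ Set.Icc a b, s < t →
      c * (t - s) * μ t ^ (2 - p) ≤ (μ s - μ t) * μ s) :
    c * p * (b - a) ≤ μ a ^ p := by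
  have main : ∀ ε ∈ Set.Ioo (0 : ℝ) 1, c * p * (1 - ε) * (b - a) ≤ μ a ^ p := by
    rintro ε ⟨hε0, hε1⟩
    set k := c * p * (1 - ε) with hk
    have hk0 : 0 < k := by have := sub_pos.2 hε1; positivity
    have hpos : ∀ t ∈ Set.Icc a b, 0 < μ t := fun t ht =>
      hb.trans_le (hμ ht ⟨hab, le_rfl⟩ ht.2)
    have hlocal : ∀ t ∈ Set.Ioc a b, ∃ s ∈ Set.Ico a t, k * (t - s) ≤ μ s ^ p - μ t ^ p := by
      intro t ht
      have htI : t ∈ Set.Icc a b := ⟨ht.1.le, ht.2⟩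
      have hy := hpos t htI
      obtain ⟨s, hs, hst⟩ := hleft t ht (ε / 2 * μ t) (by positivity)
      refine ⟨s, hs, ?_⟩
      have hsI : s ∈ Set.Icc a b := ⟨hs.1, hs.2.le.trans ht.2⟩
      have hd := hdiff s hsI t htI hs.2
      have hx := hpos s hsI
      have hyx : μ t ≤ μ s := hμ hsI htI hs.2.le
      generalize μ t = y at *
      generalize μ s = x at *
      have hr1 : y / x ≤ 1 := (div_le_one hx).2 hyx
      have hr0 : 0 < y / x := by positivity
      have hr : 1 - ε ≤ (y / x) ^ (2 - p) := by
        calc 1 - ε ≤ (y / x) ^ (2 : ℝ) := by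
              rw [Real.rpow_two, div_pow, le_div_iff₀ (by positivity)]
              have h1 : x ^ 2 ≤ (y * (1 + ε / 2)) ^ 2 := by gcongr; linarith
              have h2 : (1 - ε) * (1 + ε / 2) ^ 2 ≤ 1 := by nlinarith [pow_pos hε0 3, pow_pos hε0 2]
              calc (1 - ε) * x ^ 2 ≤ (1 - ε) * (y * (1 + ε / 2)) ^ 2 := by
                    have := sub_pos.2 hε1; gcongr
                _ = y ^ 2 * ((1 - ε) * (1 + ε / 2) ^ 2) := by ring
                _ ≤ y ^ 2 := mul_le_of_le_one_right (sq_nonneg _) h2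
          _ ≤ (y / x) ^ (2 - p) := Real.rpow_le_rpow_of_exponent_ge hr0 hr1 (by linarith)
      have hbern : (y / x) ^ p ≤ 1 + p * (y / x - 1) := by
        have := rpow_one_add_le_one_add_mul_self (s := y / x - 1) (by linarith) hp0.le hp1
        simpa using this
      have e1 : y ^ p = x ^ p * (y / x) ^ p := by
        rw [← Real.mul_rpow hx.le hr0.le]; congr 1; field_simp
      have e2 : y ^ (2 - p) = x ^ (2 - p) * (y / x) ^ (2 - p) := by
        rw [← Real.mul_rpow hx.le hr0.le]; congr 1; field_simp
      have e3 : x ^ (2 - p) * x ^ p = x ^ 2 := by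
        rw [← Real.rpow_add hx]; norm_num
      have hxp : 0 < x ^ p := by positivity
      have hts : 0 < t - s := sub_pos.2 hs.2
      have h3 : c * (t - s) * (1 - ε) ≤ x ^ p * (1 - y / x) := by
        have h4 : c * (t - s) * (x ^ (2 - p) * (1 - ε)) ≤ (x - y) * x := by
          refine le_trans ?_ hd
          rw [e2]; gcongr
        have hx2 : 0 < x ^ (2 - p) := by positivity
        refine le_of_mul_le_mul_left (a := x ^ (2 - p)) ?_ hx2
        calc x ^ (2 - p) * (c * (t - s) * (1 - ε)) ≤ (x - y) * x := by linarith
          _ = x ^ 2 * (1 - y / x) := by field_simp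
          _ = _ := by rw [← e3]; ring
      calc k * (t - s) = p * (c * (t - s) * (1 - ε)) := by rw [hk]; ring
        _ ≤ p * (x ^ p * (1 - y / x)) := by gcongr
        _ = x ^ p * (1 - (1 + p * (y / x - 1))) := by ring
        _ ≤ x ^ p * (1 - (y / x) ^ p) := by gcongr
        _ = x ^ p - y ^ p := by rw [e1]; ring
    set S := {s | s ∈ Set.Icc a b ∧ k * (b - s) ≤ μ s ^ p - μ b ^ p} with hS
    have hbS : b ∈ S := ⟨⟨hab, le_rfl⟩, by simp⟩
    have hSb : BddBelow S := ⟨a, fun s hs => hs.1.1⟩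
    set r := sInf S with hr
    have har : a ≤ r := le_csInf ⟨b, hbS⟩ fun s hs => hs.1.1
    have hrb : r ≤ b := csInf_le hSb hbS
    have hrS : r ∈ S := by
      refine ⟨⟨har, hrb⟩, ?_⟩
      refine le_of_forall_pos_le_add fun δ hδ => ?_
      obtain ⟨s, hsS, hsr⟩ := exists_lt_of_csInf_lt ⟨b, hbS⟩
        (show sInf S < r + δ / k by rw [← hr]; linarith [div_pos hδ hk0])
      have hrs : r ≤ s := csInf_le hSb hsS
      have h1 : μ s ^ p ≤ μ r ^ p :=
        Real.rpow_le_rpow (hpos s hsS.1).le (hμ ⟨har, hrb⟩ hsS.1 hrs) hp0.le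
      have h2 : k * (s - r) ≤ δ := by
        rw [mul_comm, ← le_div_iff₀ hk0]; linarith
      linarith [hsS.2]
    have hra : r = a := by
      by_contra hne
      obtain ⟨s, hs, hsk⟩ := hlocal r ⟨lt_of_le_of_ne har (Ne.symm hne), hrb⟩
      have : s ∈ S := ⟨⟨hs.1, hs.2.le.trans hrb⟩, by linarith [hrS.2]⟩
      exact absurd (csInf_le hSb this) (not_le.2 hs.2)
    have h1 := hrS.2
    rw [hra] at h1
    have h2 : 0 ≤ μ b ^ p := by positivity
    linarith
  have hlim : Filter.Tendsto (fun ε : ℝ => c * p * (1 - ε) * (b - a)) (nhdsWithin 0 (Set.Ioi 0))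
      (nhds (c * p * (1 - 0) * (b - a))) :=
    (Continuous.tendsto (by fun_prop) 0).mono_left nhdsWithin_le_nhds
  rw [sub_zero, mul_one] at hlim
  refine le_of_tendsto hlim ?_
  filter_upwards [Ioo_mem_nhdsGT (zero_lt_one' ℝ)] with ε hε
  exact main ε hε

/-- Talenti's bound for a compactly supported `C²` function solving `Δw = -N` on a superlevel
set. -/
lemma sub_le_of_lap_eq_neg {N : ℕ} (hN : 2 ≤ N) {w : EuclideanSpace ℝ (Fin N) → ℝ}
    (hw : ContDiff ℝ 2 w) (hwc : HasCompactSupport w) {s t : ℝ} (hs : 0 < s) (hst : s ≤ t)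
    (hlap : ∀ x, s < w x → lap w x = -N) {x₀ : EuclideanSpace ℝ (Fin N)} (hx₀ : t < w x₀) :
    t - s ≤ 1 / 2 * (volume.real {x | s ≤ w x} /
      volume.real (ball (0 : EuclideanSpace ℝ (Fin N)) 1)) ^ (2 / N : ℝ) := by
  have hN2 : (2 : ℝ) ≤ N := by exact_mod_cast hN
  have hN0 : (0 : ℝ) < N := by linarith
  set ω := volume.real (ball (0 : EuclideanSpace ℝ (Fin N)) 1) with hω
  have hω0 : 0 < ω := ENNReal.toReal_pos (measure_ball_pos _ _ one_pos).ne' measure_ball_lt_top.ne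
  have hfin : ∀ r > 0, volume {x | r ≤ w x} ≠ ∞ := fun r hr =>
    (hwc.isCompact.measure_lt_top.trans_le' (measure_mono fun x (hx : r ≤ w x) =>
      subset_tsupport w (by simp only [Function.mem_support]; linarith))).ne
  have hmeas : ∀ r, MeasurableSet {x | r ≤ w x} := fun r =>
    (isClosed_le continuous_const hw.continuous).measurableSet
  have key := mul_sub_le_rpow_of_antitone (μ := fun r => volume.real {x | r ≤ w x})
    (p := 2 / N) (c := N * ω ^ (2 / N : ℝ)) (a := s) (b := t) (by positivity)
    ((div_le_one hN0).2 hN2) (by positivity) hst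
    (fun r hr q _ hrq => measureReal_mono (fun x (hx : q ≤ w x) => hrq.trans hx)
      (hfin r (hs.trans_le hr.1)))
    (ENNReal.toReal_pos (Measure.measure_pos_of_mem_nhds _ (Filter.mem_of_superset
      ((isOpen_lt continuous_const hw.continuous).mem_nhds hx₀)
      fun x (hx : t < w x) => hx.le)).ne'
      (hfin t (hs.trans_le hst)))
    (by
      intro r hr η hη
      obtain ⟨q, hqm, hq, hqr⟩ := exists_seq_strictMono_tendsto' hr.1
      have hI : ⋂ n, {x | q n ≤ w x} = {x | r ≤ w x} := by
        ext x
        simp only [Set.mem_iInter, Set.mem_ofPred_eq]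
        exact ⟨fun h => le_of_tendsto' hqr h, fun h n => (hq n).2.le.trans h⟩
      have hlim := tendsto_measure_iInter_atTop (μ := volume) (s := fun n => {x | q n ≤ w x})
        (fun n => (hmeas _).nullMeasurableSet)
        (fun m n hmn x (hx : q n ≤ w x) => (hqm.monotone hmn).trans hx)
        ⟨0, hfin _ (hs.trans (hq 0).1)⟩
      rw [hI] at hlim
      have hlim' := (ENNReal.tendsto_toReal (hfin r (hs.trans hr.1))).comp hlim
      obtain ⟨n, hn⟩ := (hlim'.eventually_lt_const
        (lt_add_of_pos_right (volume {x | r ≤ w x}).toReal hη)).exists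
      exact ⟨q n, ⟨(hq n).1.le, (hq n).2⟩, hn⟩)
    (by
      intro q hq r hr hqr
      have := level_set_estimate hN hw hwc (hs.trans_le hq.1) hqr
        fun x hx => hlap x (hq.1.trans_lt hx)
      calc _ = _ := by ring
        _ ≤ _ := this)
  rw [Real.div_rpow measureReal_nonneg hω0.le]
  have hωp : 0 < ω ^ (2 / N : ℝ) := by positivity
  have e : (N : ℝ) * ω ^ (2 / N : ℝ) * (2 / N) * (t - s) = ω ^ (2 / N : ℝ) * (2 * (t - s)) := by
    field_simp
  rw [e, mul_comm, ← le_div_iff₀ hωp] at key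
  linarith

/-- A solution of `Δu = N` vanishing on the boundary can be cut off below a positive level of `-u`
to a compactly supported `C²` function on the whole space. -/
lemma exists_contDiff_cutoff {N : ℕ} {Ω : Set (EuclideanSpace ℝ (Fin N))}
    (hΩo : IsOpen Ω) (hΩb : Bornology.IsBounded Ω) {u : EuclideanSpace ℝ (Fin N) → ℝ}
    (hu2 : ContDiffOn ℝ 2 u Ω) (huc : ContinuousOn u (closure Ω))
    (hlap : ∀ x ∈ Ω, lap u x = N) (hbd : ∀ x ∈ frontier Ω, u x = 0) {s : ℝ} (hs : 0 < s) :
    ∃ w : EuclideanSpace ℝ (Fin N) → ℝ, ContDiff ℝ 2 w ∧ HasCompactSupport w ∧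
      {x | s ≤ w x} ⊆ Ω ∧ (∀ x, s < w x → lap w x = -N) ∧
      ∀ x ∈ Ω, s ≤ -u x → w x = -u x := by
  set K := closure Ω ∩ {x | s ≤ -u x} with hK
  have hKc : IsCompact K := by
    refine hΩb.isCompact_closure.of_isClosed_subset ?_ Set.inter_subset_left
    exact huc.neg.preimage_isClosed_of_isClosed isClosed_closure isClosed_Ici
  have hKΩ : K ⊆ Ω := by
    rintro x ⟨hx, hxs : s ≤ -u x⟩
    by_contra hxΩ
    have := hbd x ⟨hx, by rwa [hΩo.interior_eq]⟩
    linarith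
  obtain ⟨L, hL, hKL, hLΩ⟩ := exists_compact_between hKc hΩo hKΩ
  obtain ⟨χ, hχ1, hχ0, hχ⟩ := exists_contMDiffMap_one_nhds_of_subset_interior
    (modelWithCornersSelf ℝ (EuclideanSpace ℝ (Fin N))) (n := 2) hKc.isClosed hKL
  have hχc : ContDiff ℝ 2 χ := χ.contMDiff.contDiff
  have hsupp : Function.support (fun x => χ x * -u x) ⊆ L := by
    intro x hx
    by_contra hxL
    exact hx (by simp [hχ0 x hxL])
  have hw0 : ∀ x, s ≤ χ x * -u x → x ∈ K := by
    intro x hx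
    have hxL : x ∈ L := hsupp (by simp only [Function.mem_support]; linarith)
    refine ⟨subset_closure (hLΩ hxL), ?_⟩
    have h0 := (hχ x).1
    have h1 := (hχ x).2
    have hux : 0 ≤ -u x := by
      by_contra! h
      linarith [mul_nonpos_of_nonneg_of_nonpos h0 h.le]
    exact hx.trans (mul_le_of_le_one_left hux h1)
  have hev : ∀ x ∈ K, (fun x => χ x * -u x) =ᶠ[nhds x] -u := by
    intro x hx
    filter_upwards [hχ1.filter_mono (nhds_le_nhdsSet hx)] with y hy
    simp [hy]
  refine ⟨fun x => χ x * -u x, ?_, .of_support_subset_isCompact hL hsupp,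
    fun x hx => hKΩ (hw0 x hx), fun x hx => ?_, fun x hx hxs => ?_⟩
  · rw [contDiff_iff_contDiffAt]
    intro x
    by_cases hx : x ∈ Ω
    · exact hχc.contDiffAt.mul (hu2.contDiffAt (hΩo.mem_nhds hx)).neg
    · have hxL : x ∈ Lᶜ := fun h => hx (hLΩ h)
      refine (contDiffAt_const (c := (0 : ℝ))).congr_of_eventuallyEq ?_
      filter_upwards [hL.isClosed.isOpen_compl.mem_nhds hxL] with y hy
      simp [hχ0 y hy]
  · have hxK := hw0 x hx.le
    rw [← hlap x (hKΩ hxK)]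
    simp only [lap, ((hev x hxK).iteratedFDeriv ℝ 2).eq_of_nhds,
      iteratedFDeriv_neg_apply, neg_apply, Finset.sum_neg_distrib]
  · simpa using (hev x ⟨subset_closure hx, hxs⟩).self_of_nhds

end

/-- Talenti-type bound: `max_{closure Ω} (-u) ≤ (1/2) (|Ω|/|B₁|)^{2/N}` for the
torsion function `u` of a bounded `C²` domain `Ω ⊂ ℝ^N`. -/
theorem torsion_max_talenti {N : ℕ} (hN : 2 ≤ N) (Ω : Set (EuclideanSpace ℝ (Fin N)))
    (hΩo : IsOpen Ω) (hΩb : Bornology.IsBounded Ω) (hΩc : IsConnected Ω)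
    (u : EuclideanSpace ℝ (Fin N) → ℝ)
    (hu2 : ContDiffOn ℝ 2 u Ω) (huc : ContinuousOn u (closure Ω))
    (hlap : ∀ x ∈ Ω, lap u x = N)
    (hbd : ∀ x ∈ frontier Ω, u x = 0) :
    ∀ x ∈ closure Ω,
      -u x ≤ (1/2) * ((volume Ω).toReal /
        (volume (Metric.ball (0 : EuclideanSpace ℝ (Fin N)) 1)).toReal) ^ ((2:ℝ)/N) := by
  intro x hx
  rcases le_or_gt (-u x) 0 with hux | hux
  · exact hux.trans (by positivity)
  have hxΩ : x ∈ Ω := by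
    by_contra hxΩ
    have := hbd x ⟨hx, by rwa [hΩo.interior_eq]⟩
    linarith
  have main : ∀ δ > 0, 2 * δ ≤ -u x → -u x - 2 * δ ≤ (1/2) * ((volume Ω).toReal /
      (volume (Metric.ball (0 : EuclideanSpace ℝ (Fin N)) 1)).toReal) ^ ((2:ℝ)/N) := by
    intro δ hδ hδu
    obtain ⟨w, hw, hwc, hwΩ, hwlap, hwu⟩ := exists_contDiff_cutoff hΩo hΩb hu2 huc hlap hbd hδ
    have hwx : w x = -u x := hwu x hxΩ (by linarith)
    have := sub_le_of_lap_eq_neg hN hw hwc (t := -u x - δ) hδ (by linarith) hwlap (x₀ := x)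
      (by linarith)
    calc -u x - 2 * δ = -u x - δ - δ := by ring
      _ ≤ _ := this
      _ ≤ _ := by
        have : volume.real {x | δ ≤ w x} ≤ (volume Ω).toReal :=
          measureReal_mono hwΩ hΩb.measure_lt_top.ne
        change _ ≤ 1 / 2 * (_ / volume.real _) ^ _
        gcongr
  refine le_of_forall_pos_le_add fun ε hε => ?_
  have h1 := main (min (ε / 2) (-u x / 2)) (lt_min (by linarith) (by linarith))
    (by linarith [min_le_right (ε / 2) (-u x / 2)])
  linarith [min_le_left (ε / 2) (-u x / 2)]
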